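/- arXiv:2304.05337 — 2 statements merged into one kernel-verified Lean document; each statement's English description precedes it below -/
import Mathlib

section
/- For odd positive integers k, j, the functions hₖ(x) = 4√2 cos(πx)/(π(k² - 4x²)) satisfy the orthonormality relations ∫_{-∞}^{∞} x² hₖ(x) hⱼ(x) dx = δ_{kj}. -/
open MeasureTheory Real Set

/-- The functions `h_k(x) = 4√2 cos(πx)/(π(k² - 4x²))`. -/
noncomputable def hOrth (k : ℕ) (x : ℝ) : ℝ :=
  4 * Real.sqrt 2 * Real.cos (Real.pi * x) / (Real.pi * ((k : ℝ) ^ 2 - 4 * x ^ 2))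

theorem integral_one_sub_mul_exp {c : ℂ} (hc : c ≠ 0) :
    ∫ t in (0 : ℝ)..1, Complex.exp (c * t) * (1 - t) =
      Complex.exp c / c ^ 2 - 1 / c - 1 / c ^ 2 := by
  have h : ∀ t : ℝ, t ∈ uIcc (0 : ℝ) 1 → HasDerivAt
      (fun t : ℝ => Complex.exp (c * t) * (1 - t) / c + Complex.exp (c * t) / c ^ 2)
      (Complex.exp (c * (t : ℝ)) * (1 - (t : ℝ))) t := by
    intro t _
    have hid : HasDerivAt (fun t : ℝ => (t : ℂ)) 1 t := Complex.ofRealCLM.hasDerivAt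
    have he := (hid.const_mul c).cexp
    convert! ((he.mul (hid.const_sub 1)).div_const c).add (he.div_const (c ^ 2)) using 1
    field_simp
    ring
  rw [intervalIntegral.integral_eq_sub_of_hasDerivAt h
    (Continuous.intervalIntegrable (by fun_prop) _ _)]
  simp
  ring

theorem integral_exp_mul_one_sub_abs {c : ℂ} (hc : c ≠ 0) :
    ∫ t in (-1 : ℝ)..1, Complex.exp (c * t) * (1 - |t| : ℝ) =
      (Complex.exp c + Complex.exp (-c) - 2) / c ^ 2 := by
  rw [← intervalIntegral.integral_add_adjacent_intervals (b := 0)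
    (Continuous.intervalIntegrable (by fun_prop) _ _)
    (Continuous.intervalIntegrable (by fun_prop) _ _)]
  have hpos : ∫ t in (0 : ℝ)..1, Complex.exp (c * t) * (1 - |t| : ℝ) =
      ∫ t in (0 : ℝ)..1, Complex.exp (c * t) * (1 - t) := by
    refine intervalIntegral.integral_congr fun t ht => ?_
    rw [uIcc_of_le zero_le_one] at ht
    simp [abs_of_nonneg ht.1]
  have hneg : ∫ t in (-1 : ℝ)..0, Complex.exp (c * t) * (1 - |t| : ℝ) =
      ∫ t in (0 : ℝ)..1, Complex.exp (-c * t) * (1 - t) := by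
    have := intervalIntegral.integral_comp_neg (a := 0) (b := 1)
      (fun t : ℝ => Complex.exp (c * t) * (1 - |t| : ℝ))
    rw [neg_zero] at this
    rw [← this]
    refine intervalIntegral.integral_congr fun t ht => ?_
    rw [uIcc_of_le zero_le_one] at ht
    simp [abs_of_nonneg ht.1]
  rw [hpos, hneg, integral_one_sub_mul_exp hc, integral_one_sub_mul_exp (neg_ne_zero.2 hc)]
  field_simp
  ring

open FourierTransform in
theorem fourier_triangle {u : ℝ} (hu : u ≠ 0) :
    𝓕 (fun t : ℝ => ((max (1 - |t|) 0 : ℝ) : ℂ)) u =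
      ((sin (π * u) ^ 2 / (π * u) ^ 2 : ℝ) : ℂ) := by
  set c : ℂ := -2 * π * u * Complex.I with hc
  have hc0 : c ≠ 0 := by simp [hc, hu, Real.pi_ne_zero]
  rw [Real.fourier_real_eq_integral_exp_smul,
    ← intervalIntegral.integral_eq_integral_of_support_subset (a := -1) (b := 1)]
  · have : ∫ t in (-1 : ℝ)..1, Complex.exp (↑(-2 * π * t * u) * Complex.I) •
        ((max (1 - |t|) 0 : ℝ) : ℂ) =
        ∫ t in (-1 : ℝ)..1, Complex.exp (c * t) * (1 - |t| : ℝ) := by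
      refine intervalIntegral.integral_congr fun t ht => ?_
      rw [uIcc_of_le (by norm_num)] at ht
      have : |t| ≤ 1 := abs_le.2 ht
      simp only [smul_eq_mul]
      rw [max_eq_left (by linarith), hc]
      push_cast
      ring_nf
    rw [this, integral_exp_mul_one_sub_abs hc0]
    have h2 : Complex.exp c + Complex.exp (-c) = 2 * Complex.cos (2 * (π * u)) := by
      rw [Complex.two_cos, hc]
      ring_nf
    have hc2 : c ^ 2 = -4 * (π * u) ^ 2 := by
      rw [hc]
      linear_combination (4 * (π : ℂ) ^ 2 * u ^ 2) * Complex.I_sq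
    rw [h2, Complex.cos_two_mul, hc2, Complex.cos_sq']
    have : (π : ℂ) * u ≠ 0 := by simp [hu, Real.pi_ne_zero]
    push_cast
    field_simp
    ring
  · intro t ht
    have : 0 < 1 - |t| := by
      by_contra! h
      simp [max_eq_right h] at ht
    have := abs_lt.1 (show |t| < 1 by linarith)
    exact ⟨this.1, this.2.le⟩

theorem integrable_sin_sq_div_sq : Integrable fun u : ℝ => sin (π * u) ^ 2 / u ^ 2 := by
  refine (integrable_inv_one_add_sq.const_mul (π ^ 2 + 1)).mono'
    (Measurable.aestronglyMeasurable (by fun_prop)) (.of_forall fun u => ?_)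
  rw [Real.norm_of_nonneg (by positivity)]
  rcases eq_or_ne u 0 with rfl | hu
  · simp; positivity
  · have h1 : sin (π * u) ^ 2 ≤ (π * u) ^ 2 := sq_le_sq.2 abs_sin_le_abs
    have h2 := sin_sq_le_one (π * u)
    rw [← div_eq_mul_inv, div_le_div_iff₀ (by positivity) (by positivity)]
    nlinarith [mul_le_mul_of_nonneg_right h2 (sq_nonneg u)]

open FourierTransform in
theorem integral_sin_sq_div_sq : ∫ u : ℝ, sin (π * u) ^ 2 / u ^ 2 = π ^ 2 := by
  set f : ℝ → ℂ := fun t => ((max (1 - |t|) 0 : ℝ) : ℂ)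
  have hfc : Continuous f := by fun_prop
  have hfi : Integrable f := by
    refine hfc.integrable_of_hasCompactSupport
      (HasCompactSupport.intro (isCompact_Icc (a := -1) (b := 1)) fun t ht => ?_)
    have : 1 < |t| := by
      by_contra! h
      exact ht (abs_le.1 h)
    simp [f, max_eq_right (show 1 - |t| ≤ 0 by linarith)]
  have hF : 𝓕 f =ᵐ[volume] fun u => ((sin (π * u) ^ 2 / (π * u) ^ 2 : ℝ) : ℂ) := by
    filter_upwards [compl_mem_ae_iff.2 (measure_singleton (0 : ℝ))] with u hu
    exact fourier_triangle hu
  have hr : (fun u : ℝ => sin (π * u) ^ 2 / (π * u) ^ 2) =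
      fun u => (π ^ 2)⁻¹ * (sin (π * u) ^ 2 / u ^ 2) := by
    ext u
    rw [mul_pow, div_mul_eq_div_div, div_right_comm, div_eq_inv_mul]
  have hFi : Integrable (𝓕 f) := by
    refine Integrable.congr ?_ hF.symm
    have : Integrable fun u : ℝ => sin (π * u) ^ 2 / (π * u) ^ 2 := by
      rw [hr]
      exact integrable_sin_sq_div_sq.const_mul _
    exact this.ofReal
  have h := congrFun (hfc.fourierInv_fourier_eq hfi hFi) 0
  rw [Real.fourierInv_eq] at h
  simp only [inner_zero_right, AddChar.map_zero_eq_one, one_smul] at h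
  rw [integral_congr_ae hF, integral_complex_ofReal, hr, integral_const_mul] at h
  have h' : (π ^ 2)⁻¹ * ∫ u : ℝ, sin (π * u) ^ 2 / u ^ 2 = 1 := by
    simp only [f, abs_zero, sub_zero, zero_le_one, sup_of_le_left] at h
    exact_mod_cast h
  have := Real.pi_ne_zero
  field_simp at h'
  exact h'

open Filter Topology in
theorem tendsto_intervalIntegral_translate {f : ℝ → ℝ} {C : ℝ} {l : Filter ℝ}
    [l.IsCountablyGenerated] (hf : Measurable f) (hC : ∀ x, |f x| ≤ C)
    (hl : ∀ x, Tendsto (fun R => f (R + x)) l (𝓝 0)) (a b : ℝ) :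
    Tendsto (fun R => ∫ x in R + a..R + b, f x) l (𝓝 0) := by
  simp_rw [← intervalIntegral.integral_comp_add_left f]
  have := intervalIntegral.tendsto_integral_filter_of_dominated_convergence
    (μ := volume) (a := a) (b := b) (F := fun R x => f (R + x)) (f := fun _ => 0) (l := l)
    (fun _ => C) (.of_forall fun R => Measurable.aestronglyMeasurable (by fun_prop))
    (.of_forall fun R => .of_forall fun x _ => hC _) intervalIntegrable_const
    (.of_forall fun x _ => hl x)
  simpa using this

theorem measurable_sin_sq_div : Measurable fun u : ℝ => sin (π * u) ^ 2 / u := by fun_prop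

theorem abs_sin_sq_div_le (u : ℝ) : |sin (π * u) ^ 2 / u| ≤ π := by
  rcases eq_or_ne u 0 with rfl | hu
  · simp [pi_pos.le]
  · rw [abs_div, abs_pow, div_le_iff₀ (abs_pos.2 hu)]
    have h1 : |sin (π * u)| ≤ π * |u| := by
      simpa [abs_mul, abs_of_pos pi_pos] using abs_sin_le_abs (x := π * u)
    nlinarith [abs_sin_le_one (π * u), abs_nonneg (sin (π * u))]

theorem intervalIntegrable_sin_sq_div (a b : ℝ) :
    IntervalIntegrable (fun u : ℝ => sin (π * u) ^ 2 / u) volume a b :=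
  (intervalIntegrable_const (c := π)).mono_fun'
    measurable_sin_sq_div.aestronglyMeasurable (.of_forall abs_sin_sq_div_le)

open Filter Topology in
theorem tendsto_integral_sin_sq_div_translate_sub (a b : ℝ) :
    Tendsto (fun R : ℝ => ∫ x in -R..R,
      (sin (π * (x - a)) ^ 2 / (x - a) - sin (π * (x - b)) ^ 2 / (x - b))) atTop (𝓝 0) := by
  set f : ℝ → ℝ := fun u => sin (π * u) ^ 2 / u with hf
  have hlim {l : Filter ℝ} (hl : Tendsto (fun x : ℝ => x⁻¹) l (𝓝 0)) : Tendsto f l (𝓝 0) := by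
    simp only [hf, div_eq_mul_inv]
    exact bdd_le_mul_tendsto_zero (.of_forall fun u => sq_nonneg _)
      (.of_forall fun u => sin_sq_le_one _) hl
  have htop := tendsto_intervalIntegral_translate measurable_sin_sq_div abs_sin_sq_div_le
    (fun x => (hlim tendsto_inv_atTop_zero).comp (tendsto_atTop_add_const_right _ x tendsto_id))
    (-b) (-a)
  have hbot := (tendsto_intervalIntegral_translate measurable_sin_sq_div abs_sin_sq_div_le
    (fun x => (hlim tendsto_inv_atBot_zero).comp (tendsto_atBot_add_const_right _ x tendsto_id))
    (-b) (-a)).comp tendsto_neg_atTop_atBot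
  have hsub := htop.sub hbot
  rw [sub_zero] at hsub
  refine hsub.congr fun R => ?_
  have hi (c : ℝ) : IntervalIntegrable (fun x => f (x - c)) volume (-R) R := by
    have := (intervalIntegrable_sin_sq_div (-R - c) (R - c)).comp_sub_right c
    simpa using this
  change _ = ∫ x in -R..R, (f (x - a) - f (x - b))
  rw [intervalIntegral.integral_sub (hi a) (hi b), intervalIntegral.integral_comp_sub_right f,
    intervalIntegral.integral_comp_sub_right f,
    intervalIntegral.integral_interval_sub_interval_comm' (intervalIntegrable_sin_sq_div _ _)
      (intervalIntegrable_sin_sq_div _ _) (intervalIntegrable_sin_sq_div _ _)]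
  simp only [Function.comp_apply, ← sub_eq_add_neg]

theorem cos_sq_eq_sin_sq_sub {a : ℝ} (ha : cos (π * a) = 0) (x : ℝ) :
    cos (π * x) ^ 2 = sin (π * (x - a)) ^ 2 := by
  have h := sin_sq_add_cos_sq (π * a)
  rw [ha] at h
  rw [mul_sub, sin_sub, ha]
  linear_combination -cos (π * x) ^ 2 * h

theorem memLp_cos_div_sub {a : ℝ} (ha : cos (π * a) = 0) :
    MemLp (fun x : ℝ => cos (π * x) / (x - a)) 2 := by
  rw [memLp_two_iff_integrable_sq (Measurable.aestronglyMeasurable (by fun_prop))]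
  simp_rw [div_pow, cos_sq_eq_sin_sq_sub ha]
  exact integrable_sin_sq_div_sq.comp_sub_right a

theorem integrable_cos_div_sub_mul {a b : ℝ} (ha : cos (π * a) = 0) (hb : cos (π * b) = 0) :
    Integrable fun x : ℝ => cos (π * x) / (x - a) * (cos (π * x) / (x - b)) :=
  (memLp_cos_div_sub ha).integrable_mul (memLp_cos_div_sub hb)

theorem integral_cos_div_sub_mul_self {a : ℝ} (ha : cos (π * a) = 0) :
    ∫ x : ℝ, cos (π * x) / (x - a) * (cos (π * x) / (x - a)) = π ^ 2 := by
  simp_rw [← sq, div_pow, cos_sq_eq_sin_sq_sub ha]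
  rw [integral_sub_right_eq_self (fun u : ℝ => sin (π * u) ^ 2 / u ^ 2) a,
    integral_sin_sq_div_sq]

open Filter in
theorem integral_cos_div_sub_mul_of_ne {a b : ℝ} (ha : cos (π * a) = 0) (hb : cos (π * b) = 0)
    (hab : a ≠ b) : ∫ x : ℝ, cos (π * x) / (x - a) * (cos (π * x) / (x - b)) = 0 := by
  have hsub : a - b ≠ 0 := sub_ne_zero.2 hab
  refine tendsto_nhds_unique (intervalIntegral_tendsto_integral (integrable_cos_div_sub_mul ha hb)
    tendsto_neg_atTop_atBot tendsto_id) ?_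
  have h := (tendsto_integral_sin_sq_div_translate_sub a b).const_mul (a - b)⁻¹
  rw [mul_zero] at h
  refine h.congr fun R => ?_
  rw [← intervalIntegral.integral_const_mul]
  refine intervalIntegral.integral_congr fun x _ => ?_
  simp only [← cos_sq_eq_sin_sq_sub ha, ← cos_sq_eq_sin_sq_sub hb]
  rcases eq_or_ne x a with rfl | hxa
  · simp [ha]
  rcases eq_or_ne x b with rfl | hxb
  · simp [hb]
  have := sub_ne_zero.2 hxa
  have := sub_ne_zero.2 hxb
  field_simp
  ring

theorem cos_pi_mul_half_odd {k : ℕ} (hk : Odd k) : cos (π * (k / 2)) = 0 := by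
  obtain ⟨m, rfl⟩ := hk
  rw [cos_eq_zero_iff]
  exact ⟨m, by push_cast; ring⟩

theorem mul_hOrth {k : ℕ} (hk : Odd k) (x : ℝ) :
    x * hOrth k x = -(√2 / (2 * π)) *
      (cos (π * x) / (x - k / 2) + cos (π * x) / (x - -(k / 2))) := by
  have hc := cos_pi_mul_half_odd hk
  have hπ := pi_ne_zero
  rw [hOrth]
  rcases eq_or_ne x (k / 2) with rfl | h1
  · simp [hc]
  rcases eq_or_ne x (-(k / 2)) with rfl | h2
  · simp [hc]
  have h1' := sub_ne_zero.2 h1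
  have h2' := sub_ne_zero.2 h2
  have h3 : (k : ℝ) ^ 2 - 4 * x ^ 2 = -4 * ((x - k / 2) * (x - -(k / 2))) := by ring
  rw [h3]
  generalize hA : x - (k : ℝ) / 2 = A at *
  generalize hB : x - -((k : ℝ) / 2) = B at *
  have hx : x = (A + B) / 2 := by linarith
  field_simp
  rw [hx]
  ring

theorem hOrth_orthonormal (k j : ℕ) (hk : Odd k) (hj : Odd j) (hk1 : 1 ≤ k) (hj1 : 1 ≤ j) :
    (∫ x : ℝ, x ^ 2 * hOrth k x * hOrth j x) = if k = j then 1 else 0 := by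
  have hck := cos_pi_mul_half_odd hk
  have hcj := cos_pi_mul_half_odd hj
  have hck' : cos (π * -(k / 2)) = 0 := by rwa [mul_neg, cos_neg]
  have hcj' : cos (π * -(j / 2)) = 0 := by rwa [mul_neg, cos_neg]
  have hk0 : (1 : ℝ) ≤ k := by exact_mod_cast hk1
  have hj0 : (1 : ℝ) ≤ j := by exact_mod_cast hj1
  have hexp (x : ℝ) : x ^ 2 * hOrth k x * hOrth j x = 1 / (2 * π ^ 2) *
      ((cos (π * x) / (x - k / 2) * (cos (π * x) / (x - j / 2)) +
        cos (π * x) / (x - -(k / 2)) * (cos (π * x) / (x - -(j / 2)))) +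
      (cos (π * x) / (x - k / 2) * (cos (π * x) / (x - -(j / 2))) +
        cos (π * x) / (x - -(k / 2)) * (cos (π * x) / (x - j / 2)))) := by
    have h2 : √2 ^ 2 = (2 : ℝ) := sq_sqrt (by norm_num)
    have hc : (-(√2 / (2 * π))) ^ 2 = 1 / (2 * π ^ 2) := by
      rw [neg_sq, div_pow, h2]
      field_simp
    rw [← hc, show x ^ 2 * hOrth k x * hOrth j x = (x * hOrth k x) * (x * hOrth j x) by ring,
      mul_hOrth hk, mul_hOrth hj]
    ring
  have i1 := integrable_cos_div_sub_mul hck hcj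
  have i2 := integrable_cos_div_sub_mul hck' hcj'
  have i3 := integrable_cos_div_sub_mul hck hcj'
  have i4 := integrable_cos_div_sub_mul hck' hcj
  have i12 := i1.add i2
  have i34 := i3.add i4
  simp only [Pi.add_def] at i12 i34
  simp_rw [hexp]
  rw [integral_const_mul, integral_add i12 i34, integral_add i1 i2,
    integral_add i3 i4, integral_cos_div_sub_mul_of_ne hck hcj' (by linarith),
    integral_cos_div_sub_mul_of_ne hck' hcj (by linarith)]
  split_ifs with h
  · subst h
    rw [integral_cos_div_sub_mul_self hck, integral_cos_div_sub_mul_self hck']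
    have := pi_ne_zero
    field_simp
    norm_num
  · have hne : (k : ℝ) / 2 ≠ j / 2 := fun he => h (by exact_mod_cast (by linarith : (k : ℝ) = j))
    rw [integral_cos_div_sub_mul_of_ne hck hcj hne,
      integral_cos_div_sub_mul_of_ne hck' hcj' (fun he => hne (neg_injective he))]
    simp
end

section
/- Let h₀ be the entire function with h₀(x) = [(108 - 25π²x²)sin(πx) - πx(11π²x² + 108)cos(πx)]/(40π⁵x⁵), whose Fourier transform is ĥ₀(t) = (1/4 - t²)(1 - (9/5)t²)χ_{[-1/2,1/2]}(t). Then 2∫_{-∞}^{∞} x²|h₀(x)|² dx / ∫_{-∞}^{∞} |x||h₀(x)|² dx = 49484/38745. -/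
open MeasureTheory Real Set

/-- The explicit near-extremal function `h₀` for the monotone-delta problem. -/
noncomputable def hZero (x : ℝ) : ℝ :=
  ((108 - 25 * Real.pi ^ 2 * x ^ 2) * Real.sin (Real.pi * x) -
      Real.pi * x * (11 * Real.pi ^ 2 * x ^ 2 + 108) * Real.cos (Real.pi * x)) /
    (40 * Real.pi ^ 5 * x ^ 5)

open Filter Topology

/-- The fundamental theorem of calculus on `(0, ∞)` for a nonnegative derivative, where the
primitive is only assumed to have a right limit at `0`. -/
lemma integral_Ioi_zero_of_tendsto_of_nonneg {f f' : ℝ → ℝ} {l m : ℝ}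
    (hderiv : ∀ x ∈ Ioi (0 : ℝ), HasDerivAt f (f' x) x) (hpos : ∀ x ∈ Ioi (0 : ℝ), 0 ≤ f' x)
    (hzero : Tendsto f (𝓝[>] 0) (𝓝 l)) (htop : Tendsto f atTop (𝓝 m)) :
    IntegrableOn f' (Ioi 0) ∧ ∫ x in Ioi (0 : ℝ), f' x = m - l := by
  have heq : ∀ x ∈ Ioi (0 : ℝ), Function.update f 0 l x = f x := fun x hx =>
    Function.update_of_ne (ne_of_gt hx) _ _
  have hcont : ContinuousWithinAt (Function.update f 0 l) (Ici 0) 0 := by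
    rw [continuousWithinAt_update_same]
    simpa using hzero
  have hd : ∀ x ∈ Ioi (0 : ℝ), HasDerivAt (Function.update f 0 l) (f' x) x := fun x hx =>
    (hderiv x hx).congr_of_eventuallyEq (by
      filter_upwards [Ioi_mem_nhds hx] with y hy using heq y hy)
  have ht : Tendsto (Function.update f 0 l) atTop (𝓝 m) :=
    htop.congr' (by filter_upwards [Ioi_mem_atTop 0] with y hy using (heq y hy).symm)
  refine ⟨integrableOn_Ioi_deriv_of_nonneg hcont hd hpos ht, ?_⟩
  simpa using integral_Ioi_of_hasDerivAt_of_nonneg hcont hd hpos ht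

lemma lintegral_Ioi_zero_of_tendsto_of_nonneg {f f' : ℝ → ℝ} {l m : ℝ}
    (hderiv : ∀ x ∈ Ioi (0 : ℝ), HasDerivAt f (f' x) x) (hpos : ∀ x ∈ Ioi (0 : ℝ), 0 ≤ f' x)
    (hzero : Tendsto f (𝓝[>] 0) (𝓝 l)) (htop : Tendsto f atTop (𝓝 m)) :
    ∫⁻ x in Ioi (0 : ℝ), ENNReal.ofReal (f' x) = ENNReal.ofReal (m - l) := by
  obtain ⟨hint, hval⟩ := integral_Ioi_zero_of_tendsto_of_nonneg hderiv hpos hzero htop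
  rw [← hval, ofReal_integral_eq_lintegral_ofReal hint]
  exact (ae_restrict_iff' measurableSet_Ioi).2 (Eventually.of_forall hpos)

lemma tendsto_exp_neg_mul_atTop {t : ℝ} (ht : 0 < t) :
    Tendsto (fun u : ℝ => exp (-(u * t))) atTop (𝓝 0) :=
  tendsto_exp_neg_atTop_nhds_zero.comp (tendsto_id.atTop_mul_const ht)

lemma lintegral_mul_exp_neg_mul {u : ℝ} (hu : 0 < u) :
    ∫⁻ t in Ioi (0 : ℝ), ENNReal.ofReal (t * exp (-(u * t))) = ENNReal.ofReal (1 / u ^ 2) := by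
  have h := lintegral_Ioi_zero_of_tendsto_of_nonneg
    (f := fun t => -((t * u + 1) * exp (-(t * u))) / u ^ 2) (f' := fun t => t * exp (-(u * t)))
    (l := -1 / u ^ 2) (m := 0) ?_ ?_ ?_ ?_
  · rw [h]; congr 1; ring
  · intro t _
    have h1 : HasDerivAt (fun t : ℝ => t * u) u t := by
      simpa using (hasDerivAt_id t).mul_const u
    have h2 := (((h1.add_const 1).mul h1.neg.exp).neg).div_const (u ^ 2)
    refine h2.congr_deriv ?_
    simp only [Pi.neg_apply, mul_comm u t]
    field_simp
    ring
  · intro t ht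
    exact mul_nonneg (le_of_lt ht) (exp_pos _).le
  · have : ContinuousAt (fun t => -((t * u + 1) * exp (-(t * u))) / u ^ 2) 0 := by fun_prop
    simpa [ContinuousAt] using this.tendsto.mono_left (nhdsWithin_le_nhds (s := Ioi 0))
  · have hlim : Tendsto (fun y : ℝ => -(y * exp (-y) + exp (-y)) / u ^ 2) atTop (𝓝 0) := by
      have := tendsto_pow_mul_exp_neg_atTop_nhds_zero 1
      simpa using ((this.add tendsto_exp_neg_atTop_nhds_zero).neg).div_const (u ^ 2)
    refine (hlim.comp (tendsto_id.atTop_mul_const hu)).congr fun t => ?_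
    simp only [Function.comp, id]
    ring

lemma lintegral_exp_neg_mul_sin_sq {t : ℝ} (ht : 0 < t) :
    ∫⁻ u in Ioi (0 : ℝ), ENNReal.ofReal (exp (-(u * t)) * sin u ^ 2) =
      ENNReal.ofReal (2 / (t * (t ^ 2 + 4))) := by
  have h := lintegral_Ioi_zero_of_tendsto_of_nonneg
    (f := fun u => exp (-(u * t)) *
      (-1 / (2 * t) + (t * cos (2 * u) - 2 * sin (2 * u)) / (2 * (t ^ 2 + 4))))
    (f' := fun u => exp (-(u * t)) * sin u ^ 2)
    (l := -1 / (2 * t) + t / (2 * (t ^ 2 + 4))) (m := 0) ?_ ?_ ?_ ?_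
  · rw [h]; congr 1; field_simp; ring
  · intro u _
    have h1 : HasDerivAt (fun u : ℝ => u * t) t u := by
      simpa using (hasDerivAt_id u).mul_const t
    have h0 : HasDerivAt (fun u : ℝ => 2 * u) 2 u := by
      simpa using (hasDerivAt_id u).const_mul 2
    have h2 := h1.neg.exp.mul ((((h0.cos.const_mul t).sub (h0.sin.const_mul 2)).div_const
      (2 * (t ^ 2 + 4))).const_add (-1 / (2 * t)))
    refine h2.congr_deriv ?_
    simp only [Pi.neg_apply, Pi.sub_apply, sin_sq_eq_half_sub]
    field_simp
    ring
  · intro u _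
    positivity
  · have : ContinuousAt (fun u => exp (-(u * t)) *
      (-1 / (2 * t) + (t * cos (2 * u) - 2 * sin (2 * u)) / (2 * (t ^ 2 + 4)))) 0 := by fun_prop
    simpa [ContinuousAt] using this.tendsto.mono_left (nhdsWithin_le_nhds (s := Ioi 0))
  · refine (tendsto_exp_neg_mul_atTop ht).zero_mul_isBoundedUnder_le ?_
    refine isBoundedUnder_of ⟨|1 / (2 * t)| + (|t| * 1 + 2 * 1) / |2 * (t ^ 2 + 4)|, fun u => ?_⟩
    simp only [Function.comp, Real.norm_eq_abs]
    refine (abs_add_le _ _).trans (add_le_add (by rw [neg_div, abs_neg]) ?_)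
    rw [abs_div]
    gcongr
    refine (abs_sub _ _).trans (add_le_add ?_ ?_)
    · rw [abs_mul]; gcongr; exact abs_cos_le_one _
    · rw [abs_mul, abs_of_pos (two_pos : (0 : ℝ) < 2)]; gcongr; exact abs_sin_le_one _

lemma lintegral_sin_sq_div_sq :
    ∫⁻ u in Ioi (0 : ℝ), ENNReal.ofReal (sin u ^ 2 / u ^ 2) = ENNReal.ofReal (π / 2) := by
  calc ∫⁻ u in Ioi (0 : ℝ), ENNReal.ofReal (sin u ^ 2 / u ^ 2)
      = ∫⁻ u in Ioi (0 : ℝ), ∫⁻ t in Ioi (0 : ℝ),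
          ENNReal.ofReal (sin u ^ 2 * (t * exp (-(u * t)))) := by
        refine setLIntegral_congr_fun measurableSet_Ioi fun u hu => ?_
        simp_rw [ENNReal.ofReal_mul (sq_nonneg (sin u))]
        rw [lintegral_const_mul _ (by fun_prop), lintegral_mul_exp_neg_mul hu,
          ← ENNReal.ofReal_mul (sq_nonneg _)]
        congr 1; ring
    _ = ∫⁻ t in Ioi (0 : ℝ), ∫⁻ u in Ioi (0 : ℝ),
          ENNReal.ofReal (sin u ^ 2 * (t * exp (-(u * t)))) :=
        lintegral_lintegral_swap (by fun_prop)
    _ = ∫⁻ t in Ioi (0 : ℝ), ENNReal.ofReal (2 / (t ^ 2 + 4)) := by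
        refine setLIntegral_congr_fun measurableSet_Ioi fun t ht => ?_
        have ht : 0 < t := ht
        have heq : ∀ u : ℝ, ENNReal.ofReal (sin u ^ 2 * (t * exp (-(u * t)))) =
            ENNReal.ofReal t * ENNReal.ofReal (exp (-(u * t)) * sin u ^ 2) := fun u => by
          rw [← ENNReal.ofReal_mul ht.le]; congr 1; ring
        simp_rw [heq]
        rw [lintegral_const_mul _ (by fun_prop), lintegral_exp_neg_mul_sin_sq ht,
          ← ENNReal.ofReal_mul ht.le]
        congr 1; field_simp
    _ = ENNReal.ofReal (π / 2) := by
        have h := lintegral_Ioi_zero_of_tendsto_of_nonneg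
          (f := fun t => arctan (t / 2)) (f' := fun t => 2 / (t ^ 2 + 4))
          (l := 0) (m := π / 2) ?_ ?_ ?_ ?_
        · simpa using h
        · intro t _
          refine (((hasDerivAt_id t).div_const 2).arctan).congr_deriv ?_
          simp only [id]
          field_simp
          ring
        · intro t _
          positivity
        · have : ContinuousAt (fun t => arctan (t / 2)) 0 := by fun_prop
          simpa [ContinuousAt] using this.tendsto.mono_left (nhdsWithin_le_nhds (s := Ioi 0))
        · exact (tendsto_arctan_atTop.mono_right nhdsWithin_le_nhds).comp
            (tendsto_id.atTop_div_const two_pos)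

lemma sinc_sq_of_pos {u : ℝ} (hu : 0 < u) : sinc u ^ 2 = sin u ^ 2 / u ^ 2 := by
  rw [sinc_of_ne_zero hu.ne', div_pow]

lemma lintegral_sinc_sq :
    ∫⁻ u in Ioi (0 : ℝ), ENNReal.ofReal (sinc u ^ 2) = ENNReal.ofReal (π / 2) := by
  rw [← lintegral_sin_sq_div_sq]
  exact setLIntegral_congr_fun measurableSet_Ioi fun u hu => by rw [sinc_sq_of_pos hu]

lemma integrableOn_sinc_sq : IntegrableOn (fun u => sinc u ^ 2) (Ioi 0) := by
  refine ⟨(continuous_sinc.pow 2).aestronglyMeasurable, ?_⟩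
  rw [hasFiniteIntegral_iff_ofReal (Eventually.of_forall fun u => sq_nonneg _),
    lintegral_sinc_sq]
  exact ENNReal.ofReal_lt_top

lemma integral_sinc_sq : ∫ u in Ioi (0 : ℝ), sinc u ^ 2 = π / 2 := by
  rw [integral_eq_lintegral_of_nonneg_ae (Eventually.of_forall fun u => sq_nonneg _)
    (continuous_sinc.pow 2).aestronglyMeasurable, lintegral_sinc_sq,
    ENNReal.toReal_ofReal (by positivity)]

lemma tendsto_integral_sinc_sq :
    Tendsto (fun u => ∫ v in (0 : ℝ)..u, sinc v ^ 2) atTop (𝓝 (π / 2)) := by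
  rw [← integral_sinc_sq]
  exact intervalIntegral_tendsto_integral_Ioi 0 integrableOn_sinc_sq tendsto_id

lemma hasDerivAt_integral_sinc_sq (u : ℝ) :
    HasDerivAt (fun u => ∫ v in (0 : ℝ)..u, sinc v ^ 2) (sinc u ^ 2) u :=
  (continuous_sinc.pow 2).integral_hasStrictDerivAt 0 u |>.hasDerivAt

lemma sum_range_two_mul_I_pow_div_factorial (u : ℝ) :
    ∑ m ∈ Finset.range 10, (((2 * u : ℝ) : ℂ) * Complex.I) ^ m / m.factorial =
      ((1 - 2 * u ^ 2 + 2 / 3 * u ^ 4 - 4 / 45 * u ^ 6 + 2 / 315 * u ^ 8 : ℝ) : ℂ) +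
      ((2 * u - 4 / 3 * u ^ 3 + 4 / 15 * u ^ 5 - 8 / 315 * u ^ 7 + 4 / 2835 * u ^ 9 : ℝ) : ℂ) *
        Complex.I := by
  have h4 : Complex.I ^ 4 = 1 := Complex.I_pow_four
  have h5 : Complex.I ^ 5 = Complex.I := by rw [pow_succ, h4, one_mul]
  have h6 : Complex.I ^ 6 = -1 := by rw [pow_succ, h5, Complex.I_mul_I]
  have h7 : Complex.I ^ 7 = -Complex.I := by rw [pow_succ, h6, neg_one_mul]
  have h8 : Complex.I ^ 8 = 1 := by rw [pow_succ, h7, neg_mul, Complex.I_mul_I, neg_neg]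
  have h9 : Complex.I ^ 9 = Complex.I := by rw [pow_succ, h8, one_mul]
  simp only [Finset.sum_range_succ, Finset.sum_range_zero, mul_pow, Complex.I_sq,
    Complex.I_pow_three, h4, h5, h6, h7, h8, h9]
  norm_num [Nat.factorial]
  ring

/-- The error of the Taylor polynomial of degree nine of `exp (2iu)` is `o(u ^ 8)`. -/
lemma tendsto_exp_two_mul_I_sub_div :
    Tendsto (fun u : ℝ => (Complex.exp ((2 * u : ℝ) * Complex.I) -
      ∑ m ∈ Finset.range 10, ((2 * u : ℝ) * Complex.I) ^ m / m.factorial) / (u : ℂ) ^ 8)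
      (𝓝[>] 0) (𝓝 0) := by
  have hlim : Tendsto (fun u : ℝ => 2 ^ 10 * u ^ 2) (𝓝[>] 0) (𝓝 0) := by
    have : ContinuousAt (fun u : ℝ => 2 ^ 10 * u ^ 2) 0 := by fun_prop
    simpa [ContinuousAt] using this.tendsto.mono_left (nhdsWithin_le_nhds (s := Ioi 0))
  refine squeeze_zero_norm' ?_ hlim
  filter_upwards [Ioo_mem_nhdsGT (show (0 : ℝ) < 1 / 2 by norm_num)] with u hu
  have hu0 : 0 < u := hu.1
  have hn : ‖((2 * u : ℝ) : ℂ) * Complex.I‖ = 2 * u := by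
    rw [norm_mul, Complex.norm_I, mul_one, Complex.norm_real, Real.norm_of_nonneg (by positivity)]
  have hb := Complex.exp_bound (x := ((2 * u : ℝ) : ℂ) * Complex.I) (n := 10)
    (by rw [hn]; linarith [hu.2]) (by norm_num)
  rw [hn] at hb
  rw [norm_div, norm_pow, Complex.norm_real, Real.norm_of_nonneg hu0.le, div_le_iff₀ (by positivity)]
  refine hb.trans ?_
  have hc : (((10 : ℕ).succ : ℝ) * (((10 : ℕ).factorial : ℝ) * (10 : ℕ))⁻¹) ≤ 1 := by
    norm_num [Nat.factorial]
  calc (2 * u) ^ 10 * _ ≤ (2 * u) ^ 10 * 1 := by gcongr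
    _ = 2 ^ 10 * u ^ 2 * u ^ 8 := by ring

lemma tendsto_cos_two_mul_sub_div :
    Tendsto (fun u : ℝ => (cos (2 * u) -
      (1 - 2 * u ^ 2 + 2 / 3 * u ^ 4 - 4 / 45 * u ^ 6 + 2 / 315 * u ^ 8)) / u ^ 8)
      (𝓝[>] 0) (𝓝 0) := by
  have h := (Complex.continuous_re.tendsto 0).comp tendsto_exp_two_mul_I_sub_div
  refine h.congr fun u => ?_
  simp only [Function.comp]
  rw [sum_range_two_mul_I_pow_div_factorial, ← Complex.ofReal_pow, Complex.div_ofReal_re,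
    Complex.sub_re, Complex.exp_ofReal_mul_I_re]
  simp only [Complex.add_re, Complex.mul_re, Complex.ofReal_re, Complex.ofReal_im, Complex.I_re,
    Complex.I_im]
  ring

lemma tendsto_sin_two_mul_sub_div :
    Tendsto (fun u : ℝ => (sin (2 * u) -
      (2 * u - 4 / 3 * u ^ 3 + 4 / 15 * u ^ 5 - 8 / 315 * u ^ 7 + 4 / 2835 * u ^ 9)) / u ^ 8)
      (𝓝[>] 0) (𝓝 0) := by
  have h := (Complex.continuous_im.tendsto 0).comp tendsto_exp_two_mul_I_sub_div
  refine h.congr fun u => ?_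
  simp only [Function.comp]
  rw [sum_range_two_mul_I_pow_div_factorial, ← Complex.ofReal_pow, Complex.div_ofReal_im,
    Complex.sub_im, Complex.exp_ofReal_mul_I_im]
  simp only [Complex.add_im, Complex.mul_im, Complex.ofReal_re, Complex.ofReal_im, Complex.I_re,
    Complex.I_im]
  ring

lemma tendsto_trig_comp_inv_atTop {a b c : ℝ → ℝ} (ha : ContinuousAt a 0) (hb : ContinuousAt b 0)
    (hc : ContinuousAt c 0) (ha0 : a 0 = 0) (hb0 : b 0 = 0) (hc0 : c 0 = 0) :
    Tendsto (fun u : ℝ => a u⁻¹ + b u⁻¹ * cos (2 * u) + c u⁻¹ * sin (2 * u)) atTop (𝓝 0) := by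
  have comp : ∀ {f : ℝ → ℝ}, ContinuousAt f 0 → f 0 = 0 →
      Tendsto (fun u : ℝ => f u⁻¹) atTop (𝓝 0) := fun {f} hf h0 => by
    have := hf.tendsto.comp tendsto_inv_atTop_zero
    rwa [h0] at this
  have hcos := (comp hb hb0).zero_mul_isBoundedUnder_le (g := fun u => cos (2 * u))
    (isBoundedUnder_of ⟨1, fun u => abs_cos_le_one _⟩)
  have hsin := (comp hc hc0).zero_mul_isBoundedUnder_le (g := fun u => sin (2 * u))
    (isBoundedUnder_of ⟨1, fun u => abs_sin_le_one _⟩)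
  simpa using ((comp ha ha0).add hcos).add hsin

/-- The rescaling of `hZero` by the factor `π`. -/
noncomputable def hZeroScaled (u : ℝ) : ℝ :=
  ((108 - 25 * u ^ 2) * sin u - u * (11 * u ^ 2 + 108) * cos u) / (40 * u ^ 5)

lemma hZero_eq_hZeroScaled (x : ℝ) : hZero x = hZeroScaled (π * x) := by
  simp only [hZero, hZeroScaled, mul_pow, mul_assoc]

lemma hZeroScaled_neg (u : ℝ) : hZeroScaled (-u) = hZeroScaled u := by
  simp only [hZeroScaled, sin_neg, cos_neg]
  rw [← neg_div_neg_eq]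
  congr 1 <;> ring

lemma hZeroScaled_abs (u : ℝ) : hZeroScaled |u| = hZeroScaled u := by
  rcases abs_choice u with h | h <;> rw [h]
  exact hZeroScaled_neg u

lemma tendsto_trig_nhdsGT_zero {b c q : ℝ → ℝ} (hb : ContinuousAt b 0) (hc : ContinuousAt c 0)
    (hq : ContinuousAt q 0) :
    Tendsto (fun u : ℝ => q u +
      b u * ((cos (2 * u) -
        (1 - 2 * u ^ 2 + 2 / 3 * u ^ 4 - 4 / 45 * u ^ 6 + 2 / 315 * u ^ 8)) / u ^ 8) +
      c u * ((sin (2 * u) -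
        (2 * u - 4 / 3 * u ^ 3 + 4 / 15 * u ^ 5 - 8 / 315 * u ^ 7 + 4 / 2835 * u ^ 9)) / u ^ 8))
      (𝓝[>] 0) (𝓝 (q 0)) := by
  have h := ((hq.tendsto.mono_left (nhdsWithin_le_nhds (s := Ioi 0))).add
    ((hb.tendsto.mono_left nhdsWithin_le_nhds).mul tendsto_cos_two_mul_sub_div)).add
    ((hc.tendsto.mono_left nhdsWithin_le_nhds).mul tendsto_sin_two_mul_sub_div)
  simpa using h

lemma hasDerivAt_trig_div_pow {a b c : ℝ → ℝ} {a' b' c' u : ℝ} (n : ℕ) (hu : u ≠ 0)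
    (ha : HasDerivAt a a' u) (hb : HasDerivAt b b' u) (hc : HasDerivAt c c' u) :
    HasDerivAt (fun u => (a u + b u * cos (2 * u) + c u * sin (2 * u)) / u ^ n)
      ((((a' + (b' + 2 * c u) * cos (2 * u) + (c' - 2 * b u) * sin (2 * u)) * u -
        n * (a u + b u * cos (2 * u) + c u * sin (2 * u)))) / u ^ (n + 1)) u := by
  have h0 : HasDerivAt (fun u : ℝ => 2 * u) 2 u := by
    simpa using (hasDerivAt_id u).const_mul 2
  refine (((ha.add (hb.mul h0.cos)).add (hc.mul h0.sin)).div (hasDerivAt_pow n u)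
    (pow_ne_zero n hu)).congr_deriv ?_
  rcases n with _ | n
  · simp
    field_simp
    ring
  · simp only [Pi.add_apply, Pi.mul_apply, Nat.add_sub_cancel]
    field_simp
    ring

lemma integral_mul_hZeroScaled_sq :
    ∫ u in Ioi (0 : ℝ), u * hZeroScaled u ^ 2 = 369 / 6400 := by
  have h := integral_Ioi_zero_of_tendsto_of_nonneg
    (f := fun u => ((-5832 - 4176 * u ^ 2 - 3001 * u ^ 4 - 242 * u ^ 6) / 12800 +
      ((5832 - 7488 * u ^ 2 - 1463 * u ^ 4) / 12800) * cos (2 * u) +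
      ((11664 * u + 576 * u ^ 3 + 242 * u ^ 5) / 12800) * sin (2 * u)) / u ^ 8)
    (f' := fun u => u * hZeroScaled u ^ 2) (l := -369 / 6400) (m := 0) ?_ ?_ ?_ ?_
  · rw [h.2]; norm_num
  · intro u hu
    have hu : u ≠ 0 := ne_of_gt hu
    have ha : HasDerivAt (fun u : ℝ => (-5832 - 4176 * u ^ 2 - 3001 * u ^ 4 - 242 * u ^ 6) / 12800)
        ((-8352 * u - 12004 * u ^ 3 - 1452 * u ^ 5) / 12800) u := by
      refine (((((hasDerivAt_pow 2 u).const_mul 4176).const_sub (-5832)).sub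
        ((hasDerivAt_pow 4 u).const_mul 3001)).sub
        ((hasDerivAt_pow 6 u).const_mul 242)).div_const 12800 |>.congr_deriv ?_
      norm_num; ring
    have hb : HasDerivAt (fun u : ℝ => (5832 - 7488 * u ^ 2 - 1463 * u ^ 4) / 12800)
        ((-14976 * u - 5852 * u ^ 3) / 12800) u := by
      refine ((((hasDerivAt_pow 2 u).const_mul 7488).const_sub 5832).sub
        ((hasDerivAt_pow 4 u).const_mul 1463)).div_const 12800 |>.congr_deriv ?_
      norm_num; ring
    have hc : HasDerivAt (fun u : ℝ => (11664 * u + 576 * u ^ 3 + 242 * u ^ 5) / 12800)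
        ((11664 + 1728 * u ^ 2 + 1210 * u ^ 4) / 12800) u := by
      refine ((((hasDerivAt_id u).const_mul 11664).add
        ((hasDerivAt_pow 3 u).const_mul 576)).add
        ((hasDerivAt_pow 5 u).const_mul 242)).div_const 12800 |>.congr_deriv ?_
      norm_num; ring
    refine (hasDerivAt_trig_div_pow 8 hu ha hb hc).congr_deriv ?_
    rw [hZeroScaled, cos_two_mul, sin_two_mul, div_pow, sub_sq, mul_pow _ (sin u), sin_sq]
    field_simp
    ring
  · intro u hu
    exact mul_nonneg (le_of_lt hu) (sq_nonneg _)
  · have h := tendsto_trig_nhdsGT_zero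
      (b := fun u => (5832 - 7488 * u ^ 2 - 1463 * u ^ 4) / 12800)
      (c := fun u => (11664 * u + 576 * u ^ 3 + 242 * u ^ 5) / 12800)
      (q := fun u => -369 / 6400 + 11723 / 1008000 * u ^ 2 - 329 / 288000 * u ^ 4 +
        121 / 4536000 * u ^ 6)
      (by fun_prop) (by fun_prop) (by fun_prop)
    norm_num only at h ⊢
    refine h.congr' ?_
    filter_upwards [self_mem_nhdsWithin] with u hu
    have hu : u ≠ 0 := ne_of_gt hu
    field_simp
    ring
  · refine (tendsto_trig_comp_inv_atTop
      (a := fun y => (-5832 * y ^ 8 - 4176 * y ^ 6 - 3001 * y ^ 4 - 242 * y ^ 2) / 12800)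
      (b := fun y => (5832 * y ^ 8 - 7488 * y ^ 6 - 1463 * y ^ 4) / 12800)
      (c := fun y => (11664 * y ^ 7 + 576 * y ^ 5 + 242 * y ^ 3) / 12800)
      (by fun_prop) (by fun_prop) (by fun_prop) (by norm_num) (by norm_num) (by norm_num)).congr' ?_
    filter_upwards [Ioi_mem_atTop 0] with u hu
    have hu : u ≠ 0 := ne_of_gt hu
    field_simp

lemma integral_sq_mul_hZeroScaled_sq :
    ∫ u in Ioi (0 : ℝ), u ^ 2 * hZeroScaled u ^ 2 = 12371 / 336000 * π := by
  have h := integral_Ioi_zero_of_tendsto_of_nonneg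
    (f := fun u => ((-174960 - 131544 * u ^ 2 - 105035 * u ^ 4 - 334 * u ^ 6) / 336000 +
      ((174960 - 218376 * u ^ 2 - 41413 * u ^ 4) / 336000) * cos (2 * u) +
      ((349920 * u + 29808 * u ^ 3 + 12538 * u ^ 5) / 336000) * sin (2 * u)) / u ^ 7 +
      12371 / 168000 * ∫ v in (0 : ℝ)..u, sinc v ^ 2)
    (f' := fun u => u ^ 2 * hZeroScaled u ^ 2) (l := 0) (m := 0 + 12371 / 168000 * (π / 2))
    ?_ ?_ ?_ ?_
  · rw [h.2]; ring
  · intro u hu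
    have hu0 : 0 < u := hu
    have hu : u ≠ 0 := ne_of_gt hu
    have ha : HasDerivAt
        (fun u : ℝ => (-174960 - 131544 * u ^ 2 - 105035 * u ^ 4 - 334 * u ^ 6) / 336000)
        ((-263088 * u - 420140 * u ^ 3 - 2004 * u ^ 5) / 336000) u := by
      refine (((((hasDerivAt_pow 2 u).const_mul 131544).const_sub (-174960)).sub
        ((hasDerivAt_pow 4 u).const_mul 105035)).sub
        ((hasDerivAt_pow 6 u).const_mul 334)).div_const 336000 |>.congr_deriv ?_
      norm_num; ring
    have hb : HasDerivAt (fun u : ℝ => (174960 - 218376 * u ^ 2 - 41413 * u ^ 4) / 336000)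
        ((-436752 * u - 165652 * u ^ 3) / 336000) u := by
      refine ((((hasDerivAt_pow 2 u).const_mul 218376).const_sub 174960).sub
        ((hasDerivAt_pow 4 u).const_mul 41413)).div_const 336000 |>.congr_deriv ?_
      norm_num; ring
    have hc : HasDerivAt (fun u : ℝ => (349920 * u + 29808 * u ^ 3 + 12538 * u ^ 5) / 336000)
        ((349920 + 89424 * u ^ 2 + 62690 * u ^ 4) / 336000) u := by
      refine ((((hasDerivAt_id u).const_mul 349920).add
        ((hasDerivAt_pow 3 u).const_mul 29808)).add
        ((hasDerivAt_pow 5 u).const_mul 12538)).div_const 336000 |>.congr_deriv ?_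
      norm_num; ring
    refine ((hasDerivAt_trig_div_pow 7 hu ha hb hc).add
      ((hasDerivAt_integral_sinc_sq u).const_mul (12371 / 168000))).congr_deriv ?_
    rw [sinc_sq_of_pos hu0, hZeroScaled, cos_two_mul, sin_two_mul, div_pow, sub_sq,
      mul_pow _ (sin u), sin_sq]
    field_simp
    ring
  · intro u _
    positivity
  · have h := tendsto_trig_nhdsGT_zero
      (b := fun u => (174960 - 218376 * u ^ 2 - 41413 * u ^ 4) / 336000 * u)
      (c := fun u => (349920 * u + 29808 * u ^ 3 + 12538 * u ^ 5) / 336000 * u)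
      (q := fun u => -12371 / 168000 * u + 84653 / 5292000 * u ^ 3 - 84941 / 52920000 * u ^ 5 +
        6269 / 119070000 * u ^ 7)
      (by fun_prop) (by fun_prop) (by fun_prop)
    have hs := ((hasDerivAt_integral_sinc_sq 0).continuousAt.tendsto.mono_left
      (nhdsWithin_le_nhds (s := Ioi 0))).const_mul (12371 / 168000)
    have hadd := h.add hs
    norm_num only [intervalIntegral.integral_same] at hadd
    refine hadd.congr' ?_
    filter_upwards [self_mem_nhdsWithin] with u hu
    have hu : u ≠ 0 := ne_of_gt hu
    congr 1
    field_simp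
    ring
  · refine Tendsto.add ((tendsto_trig_comp_inv_atTop
      (a := fun y => (-174960 * y ^ 7 - 131544 * y ^ 5 - 105035 * y ^ 3 - 334 * y) / 336000)
      (b := fun y => (174960 * y ^ 7 - 218376 * y ^ 5 - 41413 * y ^ 3) / 336000)
      (c := fun y => (349920 * y ^ 6 + 29808 * y ^ 4 + 12538 * y ^ 2) / 336000)
      (by fun_prop) (by fun_prop) (by fun_prop) (by norm_num) (by norm_num) (by norm_num)).congr' ?_)
      (tendsto_integral_sinc_sq.const_mul _)
    filter_upwards [Ioi_mem_atTop 0] with u hu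
    have hu : u ≠ 0 := ne_of_gt hu
    field_simp

lemma integral_comp_pi_mul_abs (F : ℝ → ℝ) :
    ∫ x : ℝ, F (π * |x|) = 2 / π * ∫ u in Ioi (0 : ℝ), F u := by
  rw [integral_comp_abs (f := fun x => F (π * x)), integral_comp_mul_left_Ioi F 0 pi_pos]
  simp only [mul_zero, smul_eq_mul]
  ring

lemma integral_abs_mul_hZero_sq :
    ∫ x : ℝ, |x| * hZero x ^ 2 = 369 / (3200 * π ^ 2) := by
  have heq : ∀ x : ℝ, |x| * hZero x ^ 2 =
      π⁻¹ * ((fun u => u * hZeroScaled u ^ 2) (π * |x|)) := fun x => by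
    rw [hZero_eq_hZeroScaled, ← hZeroScaled_abs, abs_mul, abs_of_pos pi_pos]
    field_simp
  simp_rw [heq]
  rw [integral_const_mul, integral_comp_pi_mul_abs (fun u => u * hZeroScaled u ^ 2),
    integral_mul_hZeroScaled_sq]
  field_simp
  norm_num

lemma integral_sq_mul_hZero_sq :
    ∫ x : ℝ, x ^ 2 * hZero x ^ 2 = 12371 / (168000 * π ^ 2) := by
  have heq : ∀ x : ℝ, x ^ 2 * hZero x ^ 2 =
      (π ^ 2)⁻¹ * ((fun u => u ^ 2 * hZeroScaled u ^ 2) (π * |x|)) := fun x => by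
    rw [hZero_eq_hZeroScaled, ← hZeroScaled_abs, abs_mul, abs_of_pos pi_pos, ← sq_abs x]
    field_simp
  simp_rw [heq]
  rw [integral_const_mul, integral_comp_pi_mul_abs (fun u => u ^ 2 * hZeroScaled u ^ 2),
    integral_sq_mul_hZeroScaled_sq]
  field_simp
  norm_num

theorem hZero_ratio :
    (2 * ∫ x : ℝ, x ^ 2 * hZero x ^ 2) / (∫ x : ℝ, |x| * hZero x ^ 2) =
      49484 / 38745 := by
  rw [integral_sq_mul_hZero_sq, integral_abs_mul_hZero_sq]
  field_simp
  norm_num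
end
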